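/- Let (ℰ,𝓕) be a resistance form on a nonempty set F with resistance metric R. Then for every x, y ∈ F and every ε > 0, R(y, {z ∈ F : R(x,z) ≤ ε}) ≥ R(x,y) − 2ε; that is, the effective resistance from y to the closed ball of radius ε around x is at least R(x,y) − 2ε. -/

import Mathlib

open Filter Topology MeasureTheory
open scoped ENNReal

/-- A resistance form `(ℰ,𝓕)` on a nonempty set `F`:
`dom` is a linear subspace of `F → ℝ` containing the constants, and `energy`
is a nonnegative symmetric bilinear form satisfying RF1–RF5. -/
structure ResistanceForm (F : Type*) where
  dom : Set (F → ℝ)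
  energy : (F → ℝ) → (F → ℝ) → ℝ
  const_mem : ∀ c : ℝ, (fun _ => c) ∈ dom
  add_mem : ∀ f ∈ dom, ∀ g ∈ dom, f + g ∈ dom
  smul_mem : ∀ (c : ℝ), ∀ f ∈ dom, c • f ∈ dom
  symm : ∀ f g, energy f g = energy g f
  add_left : ∀ f g h, energy (f + g) h = energy f h + energy g h
  smul_left : ∀ (c : ℝ) (f g), energy (c • f) g = c * energy f g
  nonneg : ∀ f ∈ dom, 0 ≤ energy f f
  -- RF1: `ℰ(f,f) = 0` iff `f` is constant
  rf1 : ∀ f ∈ dom, (energy f f = 0 ↔ ∃ c : ℝ, ∀ x, f x = c)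
  -- RF2: the quotient of `dom` by the constants is complete (hence a Hilbert space)
  rf2 : ∀ f : ℕ → F → ℝ, (∀ n, f n ∈ dom) →
    (∀ ε > (0:ℝ), ∃ N, ∀ m ≥ N, ∀ n ≥ N, energy (f m - f n) (f m - f n) < ε) →
    ∃ g ∈ dom, Tendsto (fun n => energy (f n - g) (f n - g)) atTop (𝓝 0)
  -- RF3: `dom` separates points
  rf3 : ∀ x y : F, x ≠ y → ∃ f ∈ dom, f x ≠ f y
  -- RF4: the resistance between two points is finite
  rf4 : ∀ x y : F,
    BddAbove {r : ℝ | ∃ f ∈ dom, 0 < energy f f ∧ r = |f x - f y| ^ 2 / energy f f}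
  -- RF5: the Markov property
  rf5 : ∀ f ∈ dom, (fun x => max (min (f x) 1) 0) ∈ dom ∧
    energy (fun x => max (min (f x) 1) 0) (fun x => max (min (f x) 1) 0) ≤ energy f f

namespace ResistanceForm

variable {F : Type*} (Φ : ResistanceForm F)

/-- The resistance metric `R(x,y)`. -/
noncomputable def Rmet (x y : F) : ℝ :=
  sSup {r : ℝ | ∃ f ∈ Φ.dom, 0 < Φ.energy f f ∧ r = |f x - f y| ^ 2 / Φ.energy f f}

/-- The effective resistance `R(x,A)` between a point and a set, valued in `[0,∞]`,
with `sInf ∅ = ∞`, `∞⁻¹ = 0` and `0⁻¹ = ∞`. -/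
noncomputable def resToSet (x : F) (A : Set F) : ℝ≥0∞ :=
  (sInf {e : ℝ≥0∞ | ∃ f ∈ Φ.dom, f x = 1 ∧ (∀ y ∈ A, f y = 0) ∧
    e = ENNReal.ofReal (Φ.energy f f)})⁻¹

/-- The open ball of radius `r` about `x` in the resistance metric. -/
def ball (x : F) (r : ℝ) : Set F := {y | Φ.Rmet x y < r}

end ResistanceForm

namespace ResistanceForm

variable {F : Type*} (Φ : ResistanceForm F)

theorem lincomb_mem {f g : F → ℝ} (hf : f ∈ Φ.dom) (hg : g ∈ Φ.dom) (s t : ℝ) :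
    s • f + t • g ∈ Φ.dom :=
  Φ.add_mem _ (Φ.smul_mem s f hf) _ (Φ.smul_mem t g hg)

theorem energy_smul_self (c : ℝ) (f : F → ℝ) :
    Φ.energy (c • f) (c • f) = c ^ 2 * Φ.energy f f := by
  rw [Φ.smul_left, Φ.symm, Φ.smul_left]
  ring

theorem energy_lincomb (f g : F → ℝ) (s t : ℝ) :
    Φ.energy (s • f + t • g) (s • f + t • g) =
      s ^ 2 * Φ.energy f f + 2 * s * t * Φ.energy f g + t ^ 2 * Φ.energy g g := by
  rw [Φ.add_left, Φ.smul_left, Φ.smul_left, Φ.symm f, Φ.symm g, Φ.add_left, Φ.add_left,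
    Φ.smul_left, Φ.smul_left, Φ.smul_left, Φ.smul_left, Φ.symm g f]
  ring

theorem energy_const_right {f : F → ℝ} (hf : f ∈ Φ.dom) (c : ℝ) :
    Φ.energy f (fun _ => c) = 0 := by
  have hc := (Φ.rf1 _ (Φ.const_mem c)).2 ⟨c, fun _ => rfl⟩
  by_contra hne
  have h := Φ.nonneg _ (Φ.lincomb_mem hf (Φ.const_mem c) 1
    (-(Φ.energy f f + 1) / (2 * Φ.energy f fun _ => c)))
  have hcancel : 2 * 1 * (-(Φ.energy f f + 1) / (2 * Φ.energy f fun _ => c)) *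
      (Φ.energy f fun _ => c) = -(Φ.energy f f + 1) := by
    field_simp
  rw [Φ.energy_lincomb, hc, hcancel] at h
  linarith

theorem energy_add_const {f : F → ℝ} (hf : f ∈ Φ.dom) (c : ℝ) :
    Φ.energy (f + fun _ => c) (f + fun _ => c) = Φ.energy f f := by
  have h := Φ.energy_lincomb f (fun _ => c) 1 1
  rw [Φ.energy_const_right hf, (Φ.rf1 _ (Φ.const_mem c)).2 ⟨c, fun _ => rfl⟩] at h
  simpa using h

theorem sq_sub_le_Rmet_mul_energy {f : F → ℝ} (hf : f ∈ Φ.dom) (x y : F) :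
    (f x - f y) ^ 2 ≤ Φ.Rmet x y * Φ.energy f f := by
  rcases (Φ.nonneg f hf).eq_or_lt with h | h
  · obtain ⟨c, hc⟩ := (Φ.rf1 f hf).1 h.symm
    simp [hc, ← h]
  · rw [← div_le_iff₀ h, ← sq_abs]
    exact le_csSup (Φ.rf4 x y) ⟨f, hf, h, rfl⟩

/-- Almost optimal potentials: the energy can be brought arbitrarily close to `1 / R(x,y)`. -/
theorem exists_energy_lt {x y : F} {E : ℝ} (hR : 0 < Φ.Rmet x y) (hE : (Φ.Rmet x y)⁻¹ < E) :
    ∃ f ∈ Φ.dom, f x = 0 ∧ f y = 1 ∧ (∀ z, 0 ≤ f z) ∧ Φ.energy f f < E := by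
  have hE0 : 0 < E := (inv_pos.2 hR).trans hE
  have hlt : E⁻¹ < Φ.Rmet x y := inv_lt_of_inv_lt₀ hR hE
  have hne : {r : ℝ | ∃ f ∈ Φ.dom, 0 < Φ.energy f f ∧
      r = |f x - f y| ^ 2 / Φ.energy f f}.Nonempty := by
    by_contra h
    rw [Set.not_nonempty_iff_eq_empty] at h
    rw [Rmet, h, Real.sSup_empty] at hR
    exact hR.false
  obtain ⟨_, ⟨u, hu, hpos, rfl⟩, hur⟩ := exists_lt_of_lt_csSup hne hlt
  rw [sq_abs, lt_div_iff₀ hpos] at hur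
  have hd2 : 0 < (u x - u y) ^ 2 := lt_trans (mul_pos (inv_pos.2 hE0) hpos) hur
  have hd : u y - u x ≠ 0 := by
    intro h
    rw [show u x - u y = -(u y - u x) by ring, h] at hd2
    simp at hd2
  have hmem : (u y - u x)⁻¹ • (u + fun _ => -u x) ∈ Φ.dom :=
    Φ.smul_mem _ _ (Φ.add_mem _ hu _ (Φ.const_mem _))
  obtain ⟨hm, he⟩ := Φ.rf5 _ hmem
  refine ⟨_, hm, by simp, ?_, fun z => le_max_right _ _, he.trans_lt ?_⟩
  · simp [← sub_eq_add_neg, hd]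
  · rw [Φ.energy_smul_self, Φ.energy_add_const hu, inv_pow,
      show (u y - u x) ^ 2 = (u x - u y) ^ 2 by ring, inv_mul_lt_iff₀ hd2]
    rwa [inv_mul_lt_iff₀ hE0, mul_comm] at hur

theorem min_mem {f : F → ℝ} (hf : f ∈ Φ.dom) (h0 : ∀ z, 0 ≤ f z) {a : ℝ} (ha : 0 < a) :
    (fun z => min (f z) a) ∈ Φ.dom ∧
      Φ.energy (fun z => min (f z) a) (fun z => min (f z) a) ≤ Φ.energy f f := by
  obtain ⟨hm, he⟩ := Φ.rf5 _ (Φ.smul_mem a⁻¹ f hf)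
  have heq : (fun z => min (f z) a) = a • fun z => max (min ((a⁻¹ • f) z) 1) 0 := by
    funext z
    have : 0 ≤ a⁻¹ * f z := mul_nonneg (inv_nonneg.2 ha.le) (h0 z)
    simp only [Pi.smul_apply, smul_eq_mul]
    rw [max_eq_left (le_min this zero_le_one), mul_min_of_nonneg _ _ ha.le,
      mul_inv_cancel_left₀ ha.ne', mul_one]
  rw [heq]
  refine ⟨Φ.smul_mem _ _ hm, ?_⟩
  rw [Φ.energy_smul_self]
  calc _ ≤ a ^ 2 * _ := mul_le_mul_of_nonneg_left he (sq_nonneg a)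
    _ = Φ.energy f f := by
      rw [Φ.energy_smul_self]
      field_simp

/-- Truncation decreases the energy even when tested against the original function. -/
theorem energy_min_le {f : F → ℝ} (hf : f ∈ Φ.dom) (h0 : ∀ z, 0 ≤ f z) {a : ℝ} (ha : 0 < a) :
    Φ.energy (fun z => min (f z) a) (fun z => min (f z) a) ≤
      Φ.energy f (fun z => min (f z) a) := by
  obtain ⟨hp, -⟩ := Φ.min_mem hf h0 ha
  set p : F → ℝ := fun z => min (f z) a with hpdef
  have key : ∀ l : ℝ, 0 < l → l < 1 →
      Φ.energy p p ≤ Φ.energy (l • f + (1 - l) • p) (l • f + (1 - l) • p) := by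
    intro l hl hl1
    have hle : ∀ z, 0 ≤ (l • f + (1 - l) • p) z := fun z =>
      add_nonneg (mul_nonneg hl.le (h0 z))
        (mul_nonneg (sub_nonneg.2 hl1.le) (le_min (h0 z) ha.le))
    have hmin := (Φ.min_mem (Φ.lincomb_mem hf hp l (1 - l)) hle ha).2
    have heq : (fun z => min ((l • f + (1 - l) • p) z) a) = p := by
      funext z
      simp only [Pi.add_apply, Pi.smul_apply, smul_eq_mul, hpdef]
      rcases le_total (f z) a with h | h
      · rw [min_eq_left h, show l * f z + (1 - l) * f z = f z by ring, min_eq_left h]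
      · rw [min_eq_right h]
        exact min_eq_right (by nlinarith)
    rwa [heq] at hmin
  by_contra! hlt
  have hP := Φ.nonneg p hp
  have hE := Φ.nonneg f hf
  set P := Φ.energy p p
  set c := Φ.energy f p
  set e := Φ.energy f f
  have hden : 0 < e + P + (P - c) + 2 * |c| + 1 := by
    have := abs_nonneg c
    linarith
  set l := (P - c) / (e + P + (P - c) + 2 * |c| + 1) with hl
  have hlpos : 0 < l := div_pos (by linarith) hden
  have hmul : l * (e + P + (P - c) + 2 * |c| + 1) = P - c := by
    rw [hl]; exact div_mul_cancel₀ _ hden.ne'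
  have hl1 : l < 1 := by
    rw [hl, div_lt_one hden]
    have := abs_nonneg c
    linarith
  have h := key l hlpos hl1
  rw [Φ.energy_lincomb] at h
  have h' : 0 ≤ l * (2 * (c - P) + l * (e - 2 * c + P)) := by
    change P ≤ l ^ 2 * e + 2 * l * (1 - l) * c + (1 - l) ^ 2 * P at h
    linarith
  have h'' := nonneg_of_mul_nonneg_right h' hlpos
  have : l * (e - 2 * c + P) ≤ P - c := by
    rw [← hmul]
    exact mul_le_mul_of_nonneg_left (by linarith [neg_abs_le c]) hlpos.le
  linarith

/-- An almost optimal potential is at most about `ε / R(x,y)` on the closed `ε`-ball. -/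
theorem le_of_Rmet_le {f : F → ℝ} (hf : f ∈ Φ.dom) (h0 : ∀ z, 0 ≤ f z) {x y z : F}
    (hfx : f x = 0) (hfy : f y = 1) {a ε t : ℝ} (hε : 0 < ε) (ha : 0 < a) (ha1 : a ≤ 1)
    (ht : 0 ≤ t) (ht2 : t ≤ 2) (hR : 0 < Φ.Rmet x y) (hz : Φ.Rmet x z ≤ ε)
    (he : Φ.energy f f < (Φ.Rmet x y)⁻¹ + t * a * ((2 - t) * (a / ε) - 2 * (Φ.Rmet x y)⁻¹)) :
    f z ≤ a := by
  by_contra! hfz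
  obtain ⟨hp, -⟩ := Φ.min_mem hf h0 ha
  have hpc := Φ.energy_min_le hf h0 ha
  set p : F → ℝ := fun z => min (f z) a with hpdef
  have hpx : p x = 0 := by simp [hpdef, hfx, ha.le]
  have hpy : p y = a := by simp [hpdef, hfy, ha1]
  have hpz : p z = a := min_eq_right hfz.le
  have hP := Φ.sq_sub_le_Rmet_mul_energy hp x z
  have hP' : a * (a / ε) ≤ Φ.energy p p := by
    rw [hpx, hpz] at hP
    rw [← mul_div_assoc, div_le_iff₀ hε]
    nlinarith [mul_le_mul_of_nonneg_right hz (Φ.nonneg p hp)]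
  have h := Φ.sq_sub_le_Rmet_mul_energy (Φ.lincomb_mem hf hp 1 (-t)) x y
  rw [Φ.energy_lincomb, ← inv_mul_le_iff₀ hR] at h
  simp only [Pi.add_apply, Pi.smul_apply, smul_eq_mul, hpx, hpy, hfx, hfy] at h
  have h1 := mul_le_mul_of_nonneg_left hpc ht
  have h2 := mul_le_mul_of_nonneg_left hP' (mul_nonneg ht (sub_nonneg.2 ht2))
  have h3 : 0 ≤ (Φ.Rmet x y)⁻¹ * (t * a) ^ 2 := mul_nonneg (inv_pos.2 hR).le (sq_nonneg _)
  linarith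

theorem ofReal_le_resToSet {y : F} {A : Set F} {f : F → ℝ} (hf : f ∈ Φ.dom) (hy : f y = 1)
    (hA : ∀ z ∈ A, f z = 0) {K : ℝ} (hK : K * Φ.energy f f ≤ 1) :
    ENNReal.ofReal K ≤ Φ.resToSet y A := by
  rcases le_or_gt K 0 with hK0 | hK0
  · simp [ENNReal.ofReal_of_nonpos hK0]
  rw [resToSet, ENNReal.le_inv_iff_le_inv, ← ENNReal.ofReal_inv_of_pos hK0]
  refine sInf_le_of_le ⟨f, hf, hy, hA, rfl⟩ (ENNReal.ofReal_le_ofReal ?_)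
  rwa [← one_div, le_div_iff₀' hK0]

end ResistanceForm

/-- the effective resistance from `y` to the closed ball `B̄_R(x,ε)`
is at least `R(x,y) - 2ε`. -/
theorem resToSet_closedBall_ge
    {F : Type*} [Nonempty F] (Φ : ResistanceForm F) (x y : F) (ε : ℝ) (hε : 0 < ε) :
    ENNReal.ofReal (Φ.Rmet x y - 2 * ε) ≤ Φ.resToSet y {z | Φ.Rmet x z ≤ ε} := by
  rcases le_or_gt (Φ.Rmet x y - 2 * ε) 0 with hK | hK
  · simp [ENNReal.ofReal_of_nonpos hK]
  set R := Φ.Rmet x y with hRdef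
  have hR : 0 < R := by linarith
  -- Slack parameters: the truncation level is slightly above `ε / R`.
  obtain ⟨ρ, hρ⟩ : ∃ ρ, ρ = ε / (2 * R) := ⟨_, rfl⟩
  have hρ0 : 0 < ρ := by rw [hρ]; positivity
  have hρ1 : ρ < 1 / 4 := by rw [hρ, div_lt_iff₀ (by positivity)]; linarith
  have hεR : ε = 2 * ρ * R := by rw [hρ]; field_simp
  obtain ⟨a, ha⟩ : ∃ a, a = 2 * ρ * (1 + ρ) := ⟨_, rfl⟩
  have ha0 : 0 < a := by rw [ha]; positivity
  have ha1 : a < 1 := by rw [ha]; nlinarith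
  have hgap1 : 0 < ρ * a * ((2 - ρ) * (a / ε) - 2 * R⁻¹) := by
    have : (2 - ρ) * (a / ε) - 2 * R⁻¹ = ρ * (1 - ρ) * R⁻¹ := by
      rw [ha, hεR]; field_simp; ring
    rw [this]
    exact mul_pos (mul_pos hρ0 ha0) (mul_pos (mul_pos hρ0 (by linarith)) (inv_pos.2 hR))
  have hgap2 : R⁻¹ < (1 - a) ^ 2 / (R - 2 * ε) := by
    rw [lt_div_iff₀ hK, inv_mul_lt_iff₀ hR, hεR, ha]
    have : 0 < R * (4 * ρ ^ 3 * (2 + ρ)) := by positivity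
    linarith
  obtain ⟨f, hf, hfx, hfy, h0, he⟩ :=
    Φ.exists_energy_lt hR (lt_min (lt_add_of_pos_right R⁻¹ hgap1) hgap2)
  obtain ⟨he1, he2⟩ := lt_min_iff.1 he
  have hball : ∀ z, Φ.Rmet x z ≤ ε → f z ≤ a := fun z hz =>
    Φ.le_of_Rmet_le hf h0 hfx hfy hε ha0 ha1.le hρ0.le (by linarith) hR hz he1
  have h1a : 0 < 1 - a := by linarith
  have hmem : (1 - a)⁻¹ • (f + fun _ => -a) ∈ Φ.dom :=
    Φ.smul_mem _ _ (Φ.add_mem _ hf _ (Φ.const_mem _))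
  obtain ⟨hm, hle⟩ := Φ.rf5 _ hmem
  refine Φ.ofReal_le_resToSet hm ?_ ?_ ?_
  · simp [hfy, ← sub_eq_add_neg, h1a.ne']
  · intro z hz
    refine max_eq_right ((min_le_left _ _).trans ?_)
    exact mul_nonpos_of_nonneg_of_nonpos (inv_pos.2 h1a).le
      (by simpa using hball z hz)
  · refine (mul_le_mul_of_nonneg_left hle hK.le).trans ?_
    rw [Φ.energy_smul_self, Φ.energy_add_const hf, inv_pow, mul_left_comm,
      inv_mul_le_iff₀ (by positivity), mul_one]
    rw [lt_div_iff₀ hK] at he2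
    linarith
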